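/- (Nondefectivity and generic rank for powers of forms, k-Waring decompositions.) Let n ≥ 1, k ≥ 1, d ≥ 1. Let Pow_{k,d,n} ⊆ S^{k*d}_n be the Zariski closure of the set {q^d : q ∈ S^k_n} of d-th powers of degree-k forms, and set N := choose (n+k−1) k. Then dim Pow_{k,d,n} = N; for every m ≥ 1 with N * (m + N) ≤ choose (n+k*d−1) (k*d), the m-th secant variety σ_m Pow_{k,d,n} has dimension exactly m * N; and for every m ≥ 1 with m * N ≥ choose (n+k*d−1) (k*d) + N^2, σ_m Pow_{k,d,n} equals all of S^{k*d}_n. -/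

import Mathlib

noncomputable section

open MvPolynomial

/-- The Zariski topology on a `ℂ`-vector space `M` (for finite-dimensional `M`,
identified with a coordinate space via a basis, this is the topology in which a set
is closed iff it is the common zero locus of a family of polynomial functions
of the coordinates). -/
def ztV (M : Type*) [AddCommGroup M] [Module ℂ M] : TopologicalSpace M :=
  TopologicalSpace.generateFrom
    { U | ∃ (k : ℕ) (p : MvPolynomial (Fin k) ℂ) (L : Fin k → M →ₗ[ℂ] ℂ),
        U = { x | MvPolynomial.eval (fun i => L i x) p ≠ 0 } }

def zIsOpenV {M : Type*} [AddCommGroup M] [Module ℂ M] (S : Set M) : Prop :=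
  @IsOpen _ (ztV M) S

def zClosureV {M : Type*} [AddCommGroup M] [Module ℂ M] (S : Set M) : Set M :=
  @closure _ (ztV M) S

/-- The topological Krull dimension of `S` (with the subspace Zariski topology):
the supremum of lengths of chains of irreducible closed subsets. -/
def zDimV {M : Type*} [AddCommGroup M] [Module ℂ M] (S : Set M) : WithBot ℕ∞ :=
  @topologicalKrullDim ↥S (TopologicalSpace.induced Subtype.val (ztV M))

/-- The `m`-th secant variety: the Zariski closure of the set of sums of `m` points of `V`. -/
def secantV {M : Type*} [AddCommGroup M] [Module ℂ M] (m : ℕ) (V : Set M) : Set M :=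
  zClosureV { p | ∃ x : Fin m → M, (∀ i, x i ∈ V) ∧ p = ∑ i, x i }

/-- `V` is `m`-identifiable: there is a dense open subset `O` of `σ_m V` such that every
`p ∈ O` is a sum of `m` points of `V`, uniquely up to a permutation of the summands. -/
def IsIdentifiableV {M : Type*} [AddCommGroup M] [Module ℂ M] (m : ℕ) (V : Set M) : Prop :=
  ∃ O : Set M, O ⊆ secantV m V ∧
    (∃ U, zIsOpenV U ∧ O = U ∩ secantV m V) ∧
    secantV m V ⊆ zClosureV O ∧
    ∀ p ∈ O,
      (∃ x : Fin m → M, (∀ i, x i ∈ V) ∧ p = ∑ i, x i) ∧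
      ∀ x y : Fin m → M, (∀ i, x i ∈ V) → (∀ i, y i ∈ V) →
        p = ∑ i, x i → p = ∑ i, y i →
          ∃ e : Equiv.Perm (Fin m), ∀ i, y i = x (e i)

/-- The variety of `d`-th powers of degree-`k` forms: the Zariski closure in
`S^{k*d}_n` of `{q^d : q ∈ S^k_n}`. -/
def PowVariety (n k d : ℕ) : Set ↥(homogeneousSubmodule (Fin n) ℂ (k * d)) :=
  zClosureV { f | ∃ q ∈ homogeneousSubmodule (Fin n) ℂ k,
    (f : MvPolynomial (Fin n) ℂ) = q ^ d }

/-- The algebra of polynomial functions on a complex vector space. -/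
def polyFun (W : Type*) [AddCommGroup W] [Module ℂ W] : Subalgebra ℂ (W → ℂ) :=
  Algebra.adjoin ℂ (Set.range fun φ : Module.Dual ℂ W => (φ : W → ℂ))

section PolyFun

variable {W W' : Type*} [AddCommGroup W] [Module ℂ W] [AddCommGroup W'] [Module ℂ W']

lemma dual_mem_polyFun (φ : Module.Dual ℂ W) : (φ : W → ℂ) ∈ polyFun W :=
  Algebra.subset_adjoin ⟨φ, rfl⟩

lemma const_mem_polyFun (c : ℂ) : (fun _ : W => c) ∈ polyFun W :=
  (polyFun W).algebraMap_mem c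

lemma comp_mem_polyFun {g : W → W'}
    (hg : ∀ φ : Module.Dual ℂ W', (fun w => φ (g w)) ∈ polyFun W) {f : W' → ℂ}
    (hf : f ∈ polyFun W') : (fun w => f (g w)) ∈ polyFun W := by
  induction hf using Algebra.adjoin_induction with
  | mem x hx => obtain ⟨φ, rfl⟩ := hx; exact hg φ
  | algebraMap r => exact const_mem_polyFun r
  | add x y _ _ hx hy => exact add_mem hx hy
  | mul x y _ _ hx hy => exact mul_mem hx hy

lemma comp_linear_mem_polyFun (g : W →ₗ[ℂ] W') {f : W' → ℂ}
    (hf : f ∈ polyFun W') : (fun w => f (g w)) ∈ polyFun W :=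
  comp_mem_polyFun (fun φ => dual_mem_polyFun (φ ∘ₗ g)) hf

lemma sum_mem_polyFun {ι : Type*} (s : Finset ι) {f : ι → W → ℂ}
    (hf : ∀ i ∈ s, f i ∈ polyFun W) : (fun w => ∑ i ∈ s, f i w) ∈ polyFun W := by
  have := sum_mem hf
  convert this using 1
  ext w; simp

lemma prod_mem_polyFun {ι : Type*} (s : Finset ι) {f : ι → W → ℂ}
    (hf : ∀ i ∈ s, f i ∈ polyFun W) : (fun w => ∏ i ∈ s, f i w) ∈ polyFun W := by
  have := prod_mem hf
  convert this using 1
  ext w; simp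

lemma det_mem_polyFun {ι : Type*} [Fintype ι] [DecidableEq ι] {A : W → Matrix ι ι ℂ}
    (hA : ∀ i j, (fun w => A w i j) ∈ polyFun W) : (fun w => (A w).det) ∈ polyFun W := by
  simp only [Matrix.det_apply]
  refine sum_mem_polyFun _ fun σ _ => ?_
  simp only [Units.smul_def, zsmul_eq_mul]
  exact mul_mem (const_mem_polyFun _) (prod_mem_polyFun _ fun i _ => hA _ _)

lemma exists_polynomial_of_mem_polyFun {f : ℂ → ℂ} (hf : f ∈ polyFun ℂ) :
    ∃ p : Polynomial ℂ, ∀ t, f t = p.eval t := by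
  induction hf using Algebra.adjoin_induction with
  | mem x hx =>
    obtain ⟨φ, rfl⟩ := hx
    refine ⟨Polynomial.C (φ 1) * Polynomial.X, fun t => ?_⟩
    have := φ.map_smul t 1
    simp only [smul_eq_mul, mul_one] at this
    exact this.trans (by rw [Polynomial.eval_mul, Polynomial.eval_C, Polynomial.eval_X, mul_comm])
  | algebraMap r => exact ⟨Polynomial.C r, fun t => by simp⟩
  | add x y _ _ hx hy =>
    obtain ⟨p, hp⟩ := hx
    obtain ⟨q, hq⟩ := hy
    exact ⟨p + q, fun t => by simp [hp, hq]⟩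
  | mul x y _ _ hx hy =>
    obtain ⟨p, hp⟩ := hx
    obtain ⟨q, hq⟩ := hy
    exact ⟨p * q, fun t => by simp [hp, hq]⟩

lemma line_mem_polyFun (x y : W) {f : W → ℂ} (hf : f ∈ polyFun W) :
    (fun t : ℂ => f (x + t • y)) ∈ polyFun ℂ := by
  refine comp_mem_polyFun (fun φ => ?_) hf
  have : (fun t : ℂ => φ (x + t • y)) =
      (fun _ : ℂ => φ x) + ((LinearMap.id : ℂ →ₗ[ℂ] ℂ) : ℂ → ℂ) * fun _ : ℂ => φ y := by
    ext t; simp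
  rw [this]
  exact add_mem (const_mem_polyFun _) (mul_mem (dual_mem_polyFun _) (const_mem_polyFun _))

/-- Polynomial functions have no zero divisors. -/
lemma exists_mul_ne_zero_of_polyFun {f g : W → ℂ} (hf : f ∈ polyFun W) (hg : g ∈ polyFun W)
    {x y : W} (hx : f x ≠ 0) (hy : g y ≠ 0) : ∃ z, f z ≠ 0 ∧ g z ≠ 0 := by
  obtain ⟨p, hp⟩ := exists_polynomial_of_mem_polyFun (line_mem_polyFun x (y - x) hf)
  obtain ⟨q, hq⟩ := exists_polynomial_of_mem_polyFun (line_mem_polyFun x (y - x) hg)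
  have hp0 : p ≠ 0 := by
    rintro rfl
    exact hx (by simpa using hp 0)
  have hq0 : q ≠ 0 := by
    rintro rfl
    exact hy (by simpa using hq 1)
  obtain ⟨t, ht⟩ := Infinite.exists_notMem_finset (p * q).roots.toFinset
  have ht' : (p * q).eval t ≠ 0 := by
    intro h
    exact ht (by simp [hp0, hq0, Polynomial.IsRoot] at h ⊢; exact h)
  rw [Polynomial.eval_mul, ← hp, ← hq] at ht'
  exact ⟨_, left_ne_zero_of_mul ht', right_ne_zero_of_mul ht'⟩

/-- The filter of sets containing a nonempty principal Zariski open set. -/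
def generic (W : Type*) [AddCommGroup W] [Module ℂ W] : Filter W where
  sets := {U | ∃ f ∈ polyFun W, (∃ x, f x ≠ 0) ∧ ∀ x, f x ≠ 0 → x ∈ U}
  univ_sets := ⟨1, one_mem _, ⟨0, one_ne_zero⟩, fun _ _ => trivial⟩
  sets_of_superset := by
    rintro U V ⟨f, hf, hx, h⟩ hUV
    exact ⟨f, hf, hx, fun x hx => hUV (h x hx)⟩
  inter_sets := by
    rintro U V ⟨f, hf, ⟨x, hx⟩, h⟩ ⟨g, hg, ⟨y, hy⟩, h'⟩
    obtain ⟨z, hz, hz'⟩ := exists_mul_ne_zero_of_polyFun hf hg hx hy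
    exact ⟨f * g, mul_mem hf hg, ⟨z, mul_ne_zero hz hz'⟩, fun w hw =>
      ⟨h w (left_ne_zero_of_mul hw), h' w (right_ne_zero_of_mul hw)⟩⟩

lemma eventually_generic {P : W → Prop} : (∀ᶠ x in generic W, P x) ↔
    ∃ f ∈ polyFun W, (∃ x, f x ≠ 0) ∧ ∀ x, f x ≠ 0 → P x := Iff.rfl

instance : (generic W).NeBot := by
  rw [Filter.neBot_iff, Ne, ← Filter.empty_mem_iff_bot]
  rintro ⟨f, -, ⟨x, hx⟩, h⟩
  exact h x hx

lemma tendsto_generic_of_surjective (g : W →ₗ[ℂ] W') (hg : Function.Surjective g) :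
    Filter.Tendsto g (generic W) (generic W') := by
  rintro U ⟨f, hf, ⟨x, hx⟩, h⟩
  obtain ⟨y, rfl⟩ := hg x
  exact ⟨_, comp_linear_mem_polyFun g hf, ⟨y, hx⟩, fun w hw => h _ hw⟩

/-- Lower semicontinuity of the rank in a polynomial family of linear maps. -/
lemma eventually_finrank_le {X Y : Type*} [AddCommGroup X] [Module ℂ X]
    [AddCommGroup Y] [Module ℂ Y] [FiniteDimensional ℂ Y] {A : W → X →ₗ[ℂ] Y}
    (hA : ∀ (x : X) (φ : Module.Dual ℂ Y), (fun w => φ (A w x)) ∈ polyFun W) (w₀ : W) :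
    ∀ᶠ w in generic W, Module.finrank ℂ (A w₀).range ≤ Module.finrank ℂ (A w).range := by
  classical
  let b := Module.finBasis ℂ (A w₀).range
  have hb : ∀ i, ∃ x, A w₀ x = b i := fun i => (b i).2
  choose x hx using hb
  obtain ⟨π, hπ⟩ := (A w₀).range.subtype.exists_leftInverse_of_injective
    (LinearMap.ker_eq_bot.2 (Submodule.subtype_injective _))
  let ψ := fun i => b.coord i ∘ₗ π
  have hψ : ∀ i j, ψ i (A w₀ (x j)) = if i = j then 1 else 0 := by
    intro i j
    have : π (b j : Y) = b j := LinearMap.congr_fun hπ (b j)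
    simp [ψ, hx, this, Finsupp.single_apply, eq_comm]
  let B : W → Matrix _ _ ℂ := fun w => Matrix.of fun i j => ψ i (A w (x j))
  refine eventually_generic.2 ⟨fun w => (B w).det, det_mem_polyFun fun i j => hA (x j) (ψ i),
    ⟨w₀, ?_⟩, ?_⟩
  · have : B w₀ = 1 := by
      ext i j
      simp [B, hψ, Matrix.one_apply]
    simp [this]
  · intro w hw
    have hli : LinearIndependent ℂ fun j => A w (x j) := by
      rw [Fintype.linearIndependent_iff]
      intro g hg
      have : (B w).mulVec g = 0 := by
        ext i
        have := congrArg (ψ i) hg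
        simpa [B, Matrix.mulVec, dotProduct, mul_comm] using this
      exact fun i => congrFun (Matrix.eq_zero_of_mulVec_eq_zero hw this) i
    have hli' : LinearIndependent ℂ fun j => (⟨A w (x j), ⟨_, rfl⟩⟩ : (A w).range) :=
      LinearIndependent.of_comp (A w).range.subtype hli
    simpa using hli'.fintype_card_le_finrank

end PolyFun

section Tangents

variable {E V : Type*} [AddCommGroup E] [Module ℂ E] [AddCommGroup V] [Module ℂ V]

/-- The sum of the images of `μ (q i)` for `i ∈ S`. -/
def tangentSum {ι : Type*} (μ : E → E →ₗ[ℂ] V) (q : ι → E) (S : Finset ι) : Submodule ℂ V :=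
  ⨆ i ∈ S, (μ (q i)).range

variable {ι κ : Type*} (μ : E → E →ₗ[ℂ] V)

lemma mem_tangentSum {q : ι → E} {S : Finset ι} {v : V} :
    v ∈ tangentSum μ q S ↔ ∃ p : ι → E, ∑ i ∈ S, μ (q i) (p i) = v := by
  rw [tangentSum, Submodule.mem_iSup_finset_iff_exists_sum]
  constructor
  · rintro ⟨p, rfl⟩
    choose r hr using fun i => (p i).2
    exact ⟨r, by simp [hr]⟩
  · rintro ⟨p, rfl⟩
    exact ⟨fun i => ⟨μ (q i) (p i), ⟨_, rfl⟩⟩, rfl⟩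

lemma tangentSum_empty (q : ι → E) : tangentSum μ q ∅ = ⊥ := by simp [tangentSum]

lemma tangentSum_insert [DecidableEq ι] (q : ι → E) (S : Finset ι) (i : ι) :
    tangentSum μ q (insert i S) = (μ (q i)).range ⊔ tangentSum μ q S :=
  Finset.iSup_insert ..

lemma tangentSum_mono (q : ι → E) {S T : Finset ι} (h : S ⊆ T) :
    tangentSum μ q S ≤ tangentSum μ q T :=
  biSup_mono fun _ hi => h hi

lemma tangentSum_map (q : ι → E) (e : κ ↪ ι) (S : Finset κ) :
    tangentSum μ q (S.map e) = tangentSum μ (fun j => q (e j)) S := by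
  refine le_antisymm (iSup₂_le fun i hi => ?_) (iSup₂_le fun j hj => ?_)
  · obtain ⟨j, hj, rfl⟩ := Finset.mem_map.1 hi
    exact le_biSup (fun j => (μ (q (e j))).range) hj
  · exact le_biSup (fun i => (μ (q i)).range) (Finset.mem_map_of_mem e hj)

/-- The linear map whose image is `tangentSum μ q S`. -/
def tangentSumMap (q : ι → E) (S : Finset ι) : (ι → E) →ₗ[ℂ] V :=
  ∑ i ∈ S, μ (q i) ∘ₗ LinearMap.proj i

lemma range_tangentSumMap (q : ι → E) (S : Finset ι) :
    (tangentSumMap μ q S).range = tangentSum μ q S := by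
  ext v
  simp [mem_tangentSum, tangentSumMap]

/-- The maximal (equivalently, generic) dimension of a sum of `m` images of `μ`. -/
def genericRank (m : ℕ) : ℕ :=
  sSup (Set.range fun q : Fin m → E => Module.finrank ℂ (tangentSum μ q Finset.univ))

lemma finrank_range_of_generic {μ : E → E →ₗ[ℂ] V} {q : ι → E}
    (hq : ∀ S : Finset ι, Module.finrank ℂ (tangentSum μ q S) = genericRank μ S.card) (i : ι) :
    Module.finrank ℂ (μ (q i)).range = genericRank μ 1 := by
  classical
  have := hq {i}
  rwa [Finset.card_singleton, ← insert_empty_eq, tangentSum_insert, tangentSum_empty,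
    sup_bot_eq] at this

variable [FiniteDimensional ℂ V]

lemma bddAbove_finrank_tangentSum (m : ℕ) : BddAbove
    (Set.range fun q : Fin m → E => Module.finrank ℂ (tangentSum μ q Finset.univ)) :=
  ⟨Module.finrank ℂ V, by rintro _ ⟨q, rfl⟩; exact Submodule.finrank_le _⟩

lemma exists_finrank_eq_genericRank (m : ℕ) :
    ∃ q : Fin m → E, Module.finrank ℂ (tangentSum μ q Finset.univ) = genericRank μ m :=
  Nat.sSup_mem (Set.range_nonempty _) (bddAbove_finrank_tangentSum μ m)

lemma finrank_le_genericRank {m : ℕ} (q : Fin m → E) :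
    Module.finrank ℂ (tangentSum μ q Finset.univ) ≤ genericRank μ m :=
  le_csSup (bddAbove_finrank_tangentSum μ m) ⟨q, rfl⟩

lemma genericRank_le (m : ℕ) : genericRank μ m ≤ Module.finrank ℂ V := by
  obtain ⟨q, hq⟩ := exists_finrank_eq_genericRank μ m
  exact hq ▸ Submodule.finrank_le _

lemma genericRank_zero : genericRank μ 0 = 0 := by
  obtain ⟨q, hq⟩ := exists_finrank_eq_genericRank μ 0
  rw [← hq, Finset.univ_eq_empty, tangentSum_empty, finrank_bot]

variable {μ}

lemma eventually_finrank_tangentSum_univ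
    (hμ : ∀ (p : E) (φ : Module.Dual ℂ V), (fun q => φ (μ q p)) ∈ polyFun E) (m : ℕ) :
    ∀ᶠ q in generic (Fin m → E),
      Module.finrank ℂ (tangentSum μ q Finset.univ) = genericRank μ m := by
  obtain ⟨q₀, hq₀⟩ := exists_finrank_eq_genericRank μ m
  have := eventually_finrank_le (A := fun q => tangentSumMap μ q (Finset.univ : Finset (Fin m)))
    (fun p φ => by
      simp only [tangentSumMap, LinearMap.sum_apply, map_sum]
      exact sum_mem_polyFun _ fun i _ =>
        comp_linear_mem_polyFun (LinearMap.proj (R := ℂ) (φ := fun _ : Fin m => E) i)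
          (hμ (p i) φ)) q₀
  filter_upwards [this] with q hq
  rw [range_tangentSumMap, range_tangentSumMap, hq₀] at hq
  exact le_antisymm (finrank_le_genericRank μ q) hq

lemma eventually_finrank_tangentSum [Fintype ι]
    (hμ : ∀ (p : E) (φ : Module.Dual ℂ V), (fun q => φ (μ q p)) ∈ polyFun E) :
    ∀ᶠ q in generic (ι → E), ∀ S : Finset ι,
      Module.finrank ℂ (tangentSum μ q S) = genericRank μ S.card := by
  classical
  rw [Filter.eventually_all]
  intro S
  let e : Fin S.card ↪ ι := S.equivFin.symm.toEmbedding.trans (Function.Embedding.subtype _)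
  have he : Finset.univ.map e = S := by
    ext i
    constructor
    · rintro h
      obtain ⟨j, -, rfl⟩ := Finset.mem_map.1 h
      exact (S.equivFin.symm j).2
    · intro h
      exact Finset.mem_map.2 ⟨S.equivFin ⟨i, h⟩, Finset.mem_univ _, by simp [e]⟩
  have ht := tendsto_generic_of_surjective (LinearMap.funLeft ℂ E e)
    (LinearMap.funLeft_surjective_of_injective _ _ _ e.injective)
  filter_upwards [ht.eventually (eventually_finrank_tangentSum_univ hμ S.card)] with q hq
  rw [← hq]
  conv_lhs => rw [← he, tangentSum_map]
  rfl

lemma finrank_inf_add_of_generic {q : ι → E}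
    (hq : ∀ S : Finset ι, Module.finrank ℂ (tangentSum μ q S) = genericRank μ S.card)
    {S : Finset ι} {i : ι} (hi : i ∉ S) :
    genericRank μ (S.card + 1) +
      Module.finrank ℂ ((μ (q i)).range ⊓ tangentSum μ q S : Submodule ℂ V) =
      genericRank μ 1 + genericRank μ S.card := by
  classical
  have := Submodule.finrank_sup_add_finrank_inf_eq (μ (q i)).range (tangentSum μ q S)
  rwa [← tangentSum_insert, hq, hq, finrank_range_of_generic hq,
    Finset.card_insert_of_notMem hi] at this

lemma genericRank_succ_le
    (hμ : ∀ (p : E) (φ : Module.Dual ℂ V), (fun q => φ (μ q p)) ∈ polyFun E) (m : ℕ) :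
    genericRank μ (m + 1) ≤ genericRank μ m + genericRank μ 1 := by
  obtain ⟨q, hq⟩ := (eventually_finrank_tangentSum (ι := Option (Fin m)) hμ).exists
  have := finrank_inf_add_of_generic hq (S := Finset.univ.map .some) (i := none) (by simp)
  simp only [Finset.card_map, Finset.card_univ, Fintype.card_fin] at this
  omega

lemma le_genericRank_succ
    (hμ : ∀ (p : E) (φ : Module.Dual ℂ V), (fun q => φ (μ q p)) ∈ polyFun E) (m : ℕ) :
    genericRank μ m ≤ genericRank μ (m + 1) := by
  obtain ⟨q, hq⟩ := (eventually_finrank_tangentSum (ι := Option (Fin m)) hμ).exists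
  have h₁ := hq (Finset.univ.map .some)
  have h₂ := hq Finset.univ
  have := Submodule.finrank_mono (tangentSum_mono μ q
    (Finset.subset_univ (Finset.univ.map .some)))
  simp only [Finset.card_map, Finset.card_univ, Fintype.card_fin, Fintype.card_option] at h₁ h₂
  omega

lemma genericRank_concave
    (hμ : ∀ (p : E) (φ : Module.Dual ℂ V), (fun q => φ (μ q p)) ∈ polyFun E) (m : ℕ) :
    genericRank μ (m + 2) + genericRank μ m ≤ 2 * genericRank μ (m + 1) := by
  classical
  obtain ⟨q, hq⟩ := (eventually_finrank_tangentSum (ι := Option (Option (Fin m))) hμ).exists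
  let S : Finset (Option (Option (Fin m))) := (Finset.univ.map .some).map .some
  have hS : S.card = m := by simp [S]
  have hs : some none ∉ S := by simp [S]
  have h₁ := finrank_inf_add_of_generic hq (S := S) (i := none) (by simp [S])
  have h₂ := finrank_inf_add_of_generic hq (S := insert (some none) S) (i := none) (by simp [S])
  have := Submodule.finrank_mono (inf_le_inf_left (μ (q none)).range
    (tangentSum_mono μ q (Finset.subset_insert (some none) S)))
  rw [Finset.card_insert_of_notMem hs] at h₂
  rw [hS] at h₁ h₂
  rw [show m + 1 + 1 = m + 2 from rfl] at h₂
  omega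

/-- If two consecutive increments of the generic rank agree, the intersection of a generic image
with the sum of `m` others does not depend on these others. -/
lemma inf_tangentSum_eq_of_generic {q : ι → E}
    (hq : ∀ S : Finset ι, Module.finrank ℂ (tangentSum μ q S) = genericRank μ S.card) {m : ℕ}
    (hm : genericRank μ (m + 2) + genericRank μ m = 2 * genericRank μ (m + 1)) {x : ι}
    {S T : Finset ι} (hS : S.card = m) (hT : T.card = m) (hxS : x ∉ S) (hxT : x ∉ T) :
    (μ (q x)).range ⊓ tangentSum μ q S = (μ (q x)).range ⊓ tangentSum μ q T := by
  classical
  have step : ∀ {S : Finset ι} {y : ι}, S.card = m → x ∉ S → y ∉ S → y ≠ x →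
      (μ (q x)).range ⊓ tangentSum μ q S = (μ (q x)).range ⊓ tangentSum μ q (insert y S) := by
    intro S y hS hx hy hyx
    refine Submodule.eq_of_le_of_finrank_eq
      (inf_le_inf_left _ (tangentSum_mono μ q (Finset.subset_insert y S))) ?_
    have h₁ := finrank_inf_add_of_generic hq hx
    have h₂ := finrank_inf_add_of_generic hq (S := insert y S) (i := x) (by simp [hx, hyx.symm])
    rw [Finset.card_insert_of_notMem hy] at h₂
    rw [hS] at h₁ h₂
    rw [show m + 1 + 1 = m + 2 from rfl] at h₂
    omega
  induction h : (T \ S).card generalizing S with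
  | zero =>
    have : T ⊆ S := by simpa using h
    rw [Finset.eq_of_subset_of_card_le this (by omega)]
  | succ k ih =>
    obtain ⟨y, hy⟩ : (T \ S).Nonempty := Finset.card_pos.1 (by omega)
    have hcard : (S \ T).card = (T \ S).card := by
      have h₁ := Finset.card_sdiff_add_card_inter S T
      have h₂ := Finset.card_sdiff_add_card_inter T S
      rw [Finset.inter_comm] at h₂
      omega
    obtain ⟨z, hz⟩ : (S \ T).Nonempty := Finset.card_pos.1 (by omega)
    rw [Finset.mem_sdiff] at hy hz
    have hyx : y ≠ x := fun h => hxT (h ▸ hy.1)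
    have hzx : z ≠ x := fun h => hxS (h ▸ hz.1)
    have hyz : z ≠ y := fun h => hz.2 (h ▸ hy.1)
    have hyS : y ∉ S.erase z := fun h => hy.2 (Finset.mem_of_mem_erase h)
    have hc : (insert y (S.erase z)).card = m := by
      rw [Finset.card_insert_of_notMem hyS, Finset.card_erase_add_one hz.1, hS]
    have hx' : x ∉ insert y (S.erase z) := by
      simp [hyx.symm, hxS]
    rw [← ih hc hx', step hS hxS hy.2 hyx, step hc hx' (y := z) (by simp [hyz]) hzx,
      Finset.insert_comm, Finset.insert_erase hz.1]
    rw [Finset.sdiff_insert, Finset.card_erase_of_mem]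
    · have : T \ S.erase z = T \ S := by
        ext w
        simp only [Finset.mem_sdiff, Finset.mem_erase, not_and]
        constructor
        · rintro ⟨h₁, h₂⟩
          refine ⟨h₁, h₂ fun h => hz.2 (h ▸ h₁)⟩
        · rintro ⟨h₁, h₂⟩
          exact ⟨h₁, fun _ => h₂⟩
      rw [this, h, Nat.add_sub_cancel]
    · simp [hy.1, hyS]

/-- If the increments of the generic rank are stationary at a value which is not maximal, some
nonzero vector lies in the generic sum of `m` images. -/
lemma exists_ne_zero_eventually_mem_tangentSum
    (hμ : ∀ (p : E) (φ : Module.Dual ℂ V), (fun q => φ (μ q p)) ∈ polyFun E) {m : ℕ}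
    (hm : genericRank μ (m + 2) + genericRank μ m = 2 * genericRank μ (m + 1))
    (hlt : genericRank μ (m + 1) < genericRank μ m + genericRank μ 1) :
    ∃ v : V, v ≠ 0 ∧ ∀ᶠ q in generic (Fin m → E), v ∈ tangentSum μ q Finset.univ := by
  classical
  obtain ⟨f, hf, ⟨q₀, hq₀⟩, h⟩ := eventually_generic.1
    (eventually_finrank_tangentSum (ι := Option (Fin m ⊕ Fin m)) hμ)
  let eL : Fin m ↪ Option (Fin m ⊕ Fin m) := Function.Embedding.inl.trans .some
  let eR : Fin m ↪ Option (Fin m ⊕ Fin m) := Function.Embedding.inr.trans .some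
  let S := Finset.univ.map eL
  let T := Finset.univ.map eR
  have hS : S.card = m := by simp [S]
  have hT : T.card = m := by simp [T]
  have hxS : none ∉ S := by simp [S, eL]
  have hxT : none ∉ T := by simp [T, eR]
  have hpos : 0 < Module.finrank ℂ
      ((μ (q₀ none)).range ⊓ tangentSum μ q₀ S : Submodule ℂ V) := by
    have := finrank_inf_add_of_generic (h q₀ hq₀) hxS
    rw [hS] at this
    omega
  obtain ⟨v, hv, hv0⟩ := Submodule.exists_mem_ne_zero_of_ne_bot
    (fun h => hpos.ne' (Submodule.finrank_eq_zero.2 h))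
  refine ⟨v, hv0, ?_⟩
  let r : (Fin m → E) → Option (Fin m ⊕ Fin m) → E := fun z i =>
    Option.elim i (q₀ none) (Sum.elim (fun j => q₀ (some (.inl j))) z)
  refine eventually_generic.2 ⟨fun z => f (r z), comp_mem_polyFun (fun φ => ?_) hf,
    ⟨fun j => q₀ (some (.inr j)), ?_⟩, fun z hz => ?_⟩
  · have : (fun z => φ (r z)) = fun z => φ (r 0) +
        φ (∑ j, LinearMap.single ℂ (fun _ => E) (some (.inr j)) (z j)) := by
      ext z
      rw [← map_add]
      congr 1
      ext i
      rcases i with _ | i | i <;> simp [r, Pi.single_apply]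
    rw [this]
    refine add_mem (const_mem_polyFun _) ?_
    simp only [map_sum]
    exact sum_mem_polyFun _ fun j _ => dual_mem_polyFun
      (φ ∘ₗ LinearMap.single ℂ (fun _ => E) (some (.inr j)) ∘ₗ
        LinearMap.proj (R := ℂ) (φ := fun _ : Fin m => E) j)
  · have : r (fun j => q₀ (some (.inr j))) = q₀ := by
      ext i
      rcases i with _ | i | i <;> rfl
    simpa [this] using hq₀
  · have := inf_tangentSum_eq_of_generic (h (r z) hz) hm hS hT hxS hxT
    have hrS : tangentSum μ (r z) S = tangentSum μ q₀ S := by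
      simp only [S, tangentSum_map]; rfl
    have hrT : tangentSum μ (r z) T = tangentSum μ z Finset.univ := by
      simp only [T, tangentSum_map]; rfl
    rw [hrS, hrT] at this
    exact (this.le hv).2

end Tangents

/-- The growth of a bounded concave sequence whose increments, once smaller than the first one,
decrease strictly until the bound `D` is reached. -/
lemma concave_growth {ρ : ℕ → ℕ} {N D : ℕ} (hN : 0 < N) (h0 : ρ 0 = 0)
    (hle : ∀ m, ρ m ≤ D) (hmono : ∀ m, ρ m ≤ ρ (m + 1)) (hsub : ∀ m, ρ (m + 1) ≤ ρ m + N)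
    (hconc : ∀ m, ρ (m + 2) + ρ m ≤ 2 * ρ (m + 1))
    (hstrict : ∀ m, ρ (m + 2) + ρ m = 2 * ρ (m + 1) → ρ (m + 1) < ρ m + N → ρ m = D) :
    (∀ m, N * (m + N) ≤ D → ρ m = m * N) ∧ (∀ m, D + N ^ 2 ≤ m * N → ρ m = D) := by
  have hmon : Monotone ρ := monotone_nat_of_le_succ hmono
  obtain ⟨m₁, hm₁⟩ : ∃ m, ρ (m + 1) < ρ m + N := by
    by_contra! hc
    have : ∀ m, m ≤ ρ m := by
      intro m
      induction m with
      | zero => simp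
      | succ m ih => have := hc m; omega
    have := this (D + 1)
    have := hle (D + 1)
    omega
  classical
  let hex : ∃ m, ρ (m + 1) < ρ m + N := ⟨m₁, hm₁⟩
  obtain ⟨m₀, hm₀, hmin⟩ : ∃ m, ρ (m + 1) < ρ m + N ∧ ∀ j < m, ρ j + N ≤ ρ (j + 1) :=
    ⟨Nat.find hex, Nat.find_spec hex, fun j hj => not_lt.1 (Nat.find_min hex hj)⟩
  have hlin : ∀ m ≤ m₀, ρ m = m * N := by
    intro m hm
    induction m with
    | zero => simp [h0]
    | succ m ih =>
      have h₁ := ih (by omega)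
      have h₂ := hmin m (by omega)
      have h₃ := hsub m
      rw [add_mul, one_mul]
      omega
  have hdec : ∀ j, ρ (m₀ + j) = D ∨ ρ (m₀ + j + 1) + j + 1 ≤ ρ (m₀ + j) + N := by
    intro j
    induction j with
    | zero => right; simpa using hm₀
    | succ j ih =>
      rw [← add_assoc]
      rcases ih with ih | ih
      · left
        exact le_antisymm (hle _) (ih ▸ hmono _)
      · have h₁ := hconc (m₀ + j)
        by_cases h₂ : ρ (m₀ + j + 2) + ρ (m₀ + j) = 2 * ρ (m₀ + j + 1)
        · left
          have := hstrict _ h₂ (by omega)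
          exact le_antisymm (hle _) (this ▸ hmono _)
        · right
          have : m₀ + j + 1 + 1 = m₀ + j + 2 := by ring
          rw [this]
          omega
  have hfull : ρ (m₀ + N) = D := by
    rcases hdec N with h | h
    · exact h
    · have := hmono (m₀ + N)
      omega
  have hbound : ∀ j, ρ (m₀ + j) + j ≤ m₀ * N + j * N := by
    intro j
    induction j with
    | zero => simp [hlin m₀ le_rfl]
    | succ j ih =>
      have : ρ (m₀ + j + 1) + 1 ≤ ρ (m₀ + j) + N := by
        rcases hdec j with h | h
        · have := hle (m₀ + j + 1)
          omega
        · omega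
      rw [add_mul, one_mul, show m₀ + (j + 1) = m₀ + j + 1 from rfl]
      omega
  refine ⟨fun m hm => hlin m ?_, fun m hm => ?_⟩
  · have h₁ := hbound N
    rw [hfull] at h₁
    by_contra! hlt
    have : m₀ * N + N * N < N * (m + N) := by
      have : m₀ * N < N * m := by
        rw [mul_comm N]
        exact Nat.mul_lt_mul_of_pos_right hlt hN
      rw [mul_add]
      omega
    omega
  · have h₁ := hlin m₀ le_rfl
    have h₂ := hle m₀
    have : m₀ + N ≤ m := by
      refine Nat.le_of_mul_le_mul_right ?_ hN
      rw [add_mul, ← sq]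
      omega
    exact le_antisymm (hle m) (hfull ▸ hmon this)

section Forms

variable (n e : ℕ)

/-- The space of forms of degree `e` in `n` variables. -/
abbrev Forms : Submodule ℂ (MvPolynomial (Fin n) ℂ) := homogeneousSubmodule (Fin n) ℂ e

/-- Exponents of monomials of degree `e` in `n` variables. -/
abbrev Exponents := {α : Fin n →₀ ℕ // α.degree = e}

/-- Exponents of degree `e` correspond to multisets of size `e`. -/
def symEquivExponents : Sym (Fin n) e ≃ Exponents n e :=
  (Sym.equivNatSum (Fin n) e).trans (Equiv.subtypeEquivRight fun _ => Iff.rfl)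

instance : Fintype (Exponents n e) := Fintype.ofEquiv _ (symEquivExponents n e)

lemma card_exponents : Fintype.card (Exponents n e) = Nat.choose (n + e - 1) e := by
  rw [← Fintype.card_congr (symEquivExponents n e), Sym.card_sym_eq_choose, Fintype.card_fin]

/-- The coordinates of a form are its coefficients. -/
def coeffEquiv : Forms n e ≃ₗ[ℂ] (Exponents n e → ℂ) where
  toFun f α := coeff α.1 f.1
  map_add' f g := by ext; simp
  map_smul' c f := by ext; simp
  invFun c := ⟨∑ α, monomial α.1 (c α), sum_mem fun α _ => isHomogeneous_monomial _ α.2⟩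
  left_inv f := by
    classical
    ext β
    simp only [coeff_sum, coeff_monomial]
    by_cases hβ : β.degree = e
    · rw [Finset.sum_eq_single ⟨β, hβ⟩] <;> simp +contextual [Subtype.ext_iff]
    · rw [Finset.sum_eq_zero]
      · exact (IsHomogeneous.coeff_eq_zero f.2 hβ).symm
      · intro α _
        rw [if_neg]
        rintro rfl
        exact hβ α.2
  right_inv c := by
    classical
    ext β
    simp only [coeff_sum, coeff_monomial]
    rw [Finset.sum_eq_single β] <;> simp +contextual [Subtype.ext_iff]

/-- The monomial basis of the space of forms. -/
def formBasis : Module.Basis (Exponents n e) ℂ (Forms n e) :=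
  Module.Basis.ofEquivFun (coeffEquiv n e)

instance : FiniteDimensional ℂ (Forms n e) := (formBasis n e).finiteDimensional_of_finite

lemma finrank_forms : Module.finrank ℂ (Forms n e) = Nat.choose (n + e - 1) e := by
  rw [Module.finrank_eq_card_basis (formBasis n e), card_exponents]

variable {n e}

lemma formBasis_repr (f : Forms n e) (α : Exponents n e) :
    (formBasis n e).repr f α = coeff α.1 f.1 := rfl

lemma dual_apply_eq_sum (φ : Module.Dual ℂ (Forms n e)) (f : Forms n e) :
    φ f = ∑ α : Exponents n e, coeff α.1 f.1 * φ (formBasis n e α) := by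
  conv_lhs => rw [← (formBasis n e).sum_repr f]
  simp [formBasis_repr]

/-- A family of polynomials whose coefficients depend polynomially on the parameter. -/
def IsPolyFamily {W : Type*} [AddCommGroup W] [Module ℂ W]
    (A : W → MvPolynomial (Fin n) ℂ) : Prop :=
  ∀ α, (fun w => coeff α (A w)) ∈ polyFun W

namespace IsPolyFamily

variable {W : Type*} [AddCommGroup W] [Module ℂ W] {A B : W → MvPolynomial (Fin n) ℂ}

lemma const (f : MvPolynomial (Fin n) ℂ) : IsPolyFamily fun _ : W => f :=
  fun α => const_mem_polyFun (coeff α f)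

lemma of_linear (g : W →ₗ[ℂ] MvPolynomial (Fin n) ℂ) : IsPolyFamily fun w => g w :=
  fun α => dual_mem_polyFun (lcoeff ℂ α ∘ₗ g)

lemma add (hA : IsPolyFamily A) (hB : IsPolyFamily B) : IsPolyFamily fun w => A w + B w :=
  fun α => by simp only [coeff_add]; exact add_mem (hA α) (hB α)

lemma sum {ι : Type*} (s : Finset ι) {A : ι → W → MvPolynomial (Fin n) ℂ}
    (hA : ∀ i ∈ s, IsPolyFamily (A i)) : IsPolyFamily fun w => ∑ i ∈ s, A i w :=
  fun α => by
    simpa only [coeff_sum] using sum_mem_polyFun s fun i hi => hA i hi α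

lemma mul (hA : IsPolyFamily A) (hB : IsPolyFamily B) : IsPolyFamily fun w => A w * B w :=
  fun α => by
    classical
    simp only [coeff_mul]
    exact sum_mem_polyFun _ fun x _ => mul_mem (hA x.1) (hB x.2)

lemma pow (hA : IsPolyFamily A) (k : ℕ) : IsPolyFamily fun w => A w ^ k := by
  induction k with
  | zero => simpa using const 1
  | succ k ih => simpa only [pow_succ] using ih.mul hA

lemma dual {A : W → Forms n e} (hA : IsPolyFamily fun w => (A w).1)
    (φ : Module.Dual ℂ (Forms n e)) : (fun w => φ (A w)) ∈ polyFun W := by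
  have : (fun w => φ (A w)) = fun w => ∑ α, coeff α.1 (A w).1 * φ (formBasis n e α) :=
    funext fun w => dual_apply_eq_sum φ _
  rw [this]
  exact sum_mem_polyFun _ fun α _ => mul_mem (hA α) (const_mem_polyFun _)

end IsPolyFamily

/-- Multiplication by `q ^ c`, which is up to a factor `c + 1` the derivative of `q ↦ q ^ (c + 1)`. -/
def mulPow (n k c : ℕ) (q : Forms n k) : Forms n k →ₗ[ℂ] Forms n (k * (c + 1)) where
  toFun p := ⟨q.1 ^ c * p.1, by
    have := (IsHomogeneous.pow q.2 c).mul p.2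
    rwa [← mul_add_one] at this⟩
  map_add' p r := by ext; simp [mul_add]
  map_smul' a p := by ext; simp

lemma mulPow_mem_polyFun {k c : ℕ} (p : Forms n k) (φ : Module.Dual ℂ (Forms n (k * (c + 1)))) :
    (fun q => φ (mulPow n k c q p)) ∈ polyFun (Forms n k) :=
  IsPolyFamily.dual (((IsPolyFamily.of_linear (Forms n k).subtype).pow c).mul
    (IsPolyFamily.const p.1)) φ

/-- The linear substitution of variables given by a matrix. -/
def linSubst (g : Matrix (Fin n) (Fin n) ℂ) : MvPolynomial (Fin n) ℂ →ₐ[ℂ] MvPolynomial (Fin n) ℂ :=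
  aeval fun j => ∑ i, C (g j i) * X i

lemma linSubst_linSubst (g h : Matrix (Fin n) (Fin n) ℂ) (f : MvPolynomial (Fin n) ℂ) :
    linSubst g (linSubst h f) = linSubst (h * g) f := by
  suffices h : (linSubst g).comp (linSubst h) = linSubst (h * g) from DFunLike.congr_fun h f
  refine MvPolynomial.algHom_ext fun j => ?_
  simp only [linSubst, AlgHom.comp_apply, aeval_X, map_sum, map_mul, Matrix.mul_apply,
    Finset.sum_mul, Finset.mul_sum, algHom_C, algebraMap_eq, mul_assoc]
  exact Finset.sum_comm

lemma linSubst_one (f : MvPolynomial (Fin n) ℂ) : linSubst 1 f = f := by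
  have : linSubst (1 : Matrix (Fin n) (Fin n) ℂ) = AlgHom.id ℂ _ := by
    ext1 j
    simp [linSubst, Matrix.one_apply]
  rw [this, AlgHom.id_apply]

lemma isPolyFamily_linSubst (f : MvPolynomial (Fin n) ℂ) :
    IsPolyFamily fun g : Matrix (Fin n) (Fin n) ℂ => linSubst g f := by
  induction f using MvPolynomial.induction_on with
  | C a => simpa [linSubst] using IsPolyFamily.const (C a)
  | add p q hp hq => simpa only [map_add] using hp.add hq
  | mul_X p j hp =>
    simp only [map_mul]
    refine hp.mul ?_
    simp only [linSubst, aeval_X]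
    refine IsPolyFamily.sum _ fun i _ => IsPolyFamily.mul (fun α => ?_) (IsPolyFamily.const _)
    classical
    simp only [coeff_C]
    split_ifs
    · exact dual_mem_polyFun (W := Matrix (Fin n) (Fin n) ℂ)
        { toFun := fun g => g j i, map_add' := fun _ _ => rfl, map_smul' := fun _ _ => rfl }
    · exact const_mem_polyFun 0

/-- The action of a matrix on forms of a fixed degree. -/
def formSubst (e : ℕ) (g : Matrix (Fin n) (Fin n) ℂ) : Forms n e →ₗ[ℂ] Forms n e :=
  (linSubst g).toLinearMap.restrict fun f hf => by
    have := IsHomogeneous.aeval (n := 1) hf (fun j => ∑ i, C (g j i) * X i)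
      (fun j => IsHomogeneous.sum _ _ _ fun i _ => isHomogeneous_C_mul_X _ _)
    rwa [one_mul] at this

lemma coe_formSubst (g : Matrix (Fin n) (Fin n) ℂ) (f : Forms n e) :
    (formSubst e g f).1 = linSubst g f.1 := rfl

lemma formSubst_formSubst {g h : Matrix (Fin n) (Fin n) ℂ} (hgh : h * g = 1) (f : Forms n e) :
    formSubst e g (formSubst e h f) = f := by
  ext1
  rw [coe_formSubst, coe_formSubst, linSubst_linSubst, hgh, linSubst_one]

lemma formSubst_mulPow {k c : ℕ} (g : Matrix (Fin n) (Fin n) ℂ) (q p : Forms n k) :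
    formSubst _ g (mulPow n k c q p) = mulPow n k c (formSubst k g q) (formSubst k g p) := by
  ext1
  simp [coe_formSubst, mulPow]

/-- The space of forms is spanned by powers of linear forms. -/
lemma dual_eq_zero_of_linear_pow {φ : Module.Dual ℂ (Forms n e)}
    (hφ : ∀ (f : Forms n e) (b : Fin n → ℂ), f.1 = (∑ i, C (b i) * X i) ^ e → φ f = 0) : φ = 0 := by
  let P : MvPolynomial (Fin n) ℂ :=
    ∑ α : Exponents n e, monomial α.1 (α.1.multinomial * φ (formBasis n e α))
  have hP : P = 0 := by
    refine MvPolynomial.funext fun b => ?_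
    have h := hφ ⟨(∑ i, C (b i) * X i) ^ e, by
      simpa using IsHomogeneous.pow (IsHomogeneous.sum Finset.univ _ 1 fun i _ =>
        isHomogeneous_C_mul_X (b i) i) e⟩ b rfl
    rw [dual_apply_eq_sum] at h
    rw [map_zero, ← h, map_sum]
    refine Finset.sum_congr rfl fun α _ => ?_
    have := coeff_linearCombination_X_pow (Finsupp.equivFunOnFinite.symm b) α.1 e
    have hl : (Finsupp.equivFunOnFinite.symm b).linearCombination ℂ
        (X : Fin n → MvPolynomial (Fin n) ℂ) = ∑ i, C (b i) * X i := by
      rw [Finsupp.linearCombination_apply, Finsupp.sum_fintype _ _ (by simp)]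
      simp [smul_eq_C_mul]
    rw [hl] at this
    rw [this, eval_monomial]
    have hα := α.2
    rw [Finsupp.degree_apply] at hα
    simp [Finsupp.sum, hα]
    ring
  have hc : ∀ α, φ (formBasis n e α) = 0 := by
    classical
    intro α
    have h := congrArg (coeff α.1) hP
    rw [coeff_sum, Finset.sum_eq_single α] at h
    · rw [coeff_monomial, if_pos rfl, coeff_zero] at h
      refine (mul_eq_zero.1 h).resolve_left ?_
      rw [Nat.cast_eq_zero, Finsupp.multinomial_eq]
      exact (Nat.multinomial_pos _ _).ne'
    · intro β _ hβ
      rw [coeff_monomial, if_neg (fun h => hβ (Subtype.ext h))]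
    · simp
  exact (formBasis n e).ext fun α => by simp [hc α]

/-- The space of forms is an irreducible representation of the general linear group. -/
lemma eq_top_of_formSubst_mem {U : Submodule ℂ (Forms n e)} (hU : U ≠ ⊥)
    (h : ∀ (g : Matrix (Fin n) (Fin n) ℂ), g.det ≠ 0 → ∀ f ∈ U, formSubst e g f ∈ U) : U = ⊤ := by
  obtain ⟨f, hf, hf0⟩ := Submodule.exists_mem_ne_zero_of_ne_bot hU
  obtain ⟨a, ha⟩ : ∃ a, eval a f.1 ≠ 0 := by
    by_contra! hc
    exact hf0 (Subtype.ext (MvPolynomial.funext fun a => by simpa using hc a))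
  by_contra htop
  obtain ⟨φ, hφ, hφU⟩ := Submodule.exists_le_ker_of_lt_top U (lt_top_iff_ne_top.2 htop)
  have hzero : ∀ g : Matrix (Fin n) (Fin n) ℂ, φ (formSubst e g f) = 0 := by
    by_contra! hc
    obtain ⟨g, hg⟩ := hc
    obtain ⟨g', h₁, h₂⟩ := exists_mul_ne_zero_of_polyFun
      (IsPolyFamily.dual (A := fun g => formSubst e g f) (isPolyFamily_linSubst f.1) φ)
      (det_mem_polyFun (A := fun g : Matrix (Fin n) (Fin n) ℂ => g) fun i j =>
        dual_mem_polyFun (W := Matrix (Fin n) (Fin n) ℂ)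
        { toFun := fun g => g i j, map_add' := fun _ _ => rfl, map_smul' := fun _ _ => rfl })
      hg (y := 1) (by simp)
    exact h₁ (hφU (h g' h₂ f hf))
  refine hφ (dual_eq_zero_of_linear_pow fun p b hp => ?_)
  have hs : formSubst e (Matrix.of fun j i => a j * b i) f = eval a f.1 • p := by
    ext1
    rw [coe_formSubst, Submodule.coe_smul, hp, linSubst]
    have : (fun j => ∑ i, C ((Matrix.of fun j i => a j * b i) j i) * X i :
        Fin n → MvPolynomial (Fin n) ℂ) = fun j => C (a j) * ∑ i, C (b i) * X i := by
      ext1 j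
      simp [Finset.mul_sum, mul_assoc]
    rw [this]
    generalize ∑ i, C (b i) * X i = l
    have hfe : f.1.IsHomogeneous e := f.2
    rw [aeval_def, eval₂_eq, eval_eq, Finset.sum_smul]
    refine Finset.sum_congr rfl fun α hα => ?_
    simp only [mul_pow, Finset.prod_mul_distrib, Finset.prod_pow_eq_pow_sum]
    have hdeg : ∑ i ∈ α.support, α i = e := by
      by_contra hne
      exact mem_support_iff.1 hα (IsHomogeneous.coeff_eq_zero hfe hne)
    rw [hdeg, algebraMap_eq, smul_eq_C_mul]
    simp [mul_assoc]
  have := hzero (Matrix.of fun j i => a j * b i)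
  rw [hs, map_smul, smul_eq_mul] at this
  exact (mul_eq_zero.1 this).resolve_left ha

lemma formSubst_mem_tangentSum {k c m : ℕ} (g : Matrix (Fin n) (Fin n) ℂ) {z : Fin m → Forms n k}
    {v : Forms n (k * (c + 1))} (hv : v ∈ tangentSum (mulPow n k c) z Finset.univ) :
    formSubst _ g v ∈ tangentSum (mulPow n k c) (fun i => formSubst k g (z i)) Finset.univ := by
  obtain ⟨p, rfl⟩ := (mem_tangentSum _).1 hv
  exact (mem_tangentSum _).2 ⟨fun i => formSubst k g (p i), by simp [formSubst_mulPow]⟩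

/-- If a nonzero form lies in a generic sum of tangent spaces, this sum is everything. -/
lemma genericRank_eq_of_eventually_mem {k c m : ℕ} {v : Forms n (k * (c + 1))} (hv : v ≠ 0)
    (h : ∀ᶠ z in generic (Fin m → Forms n k), v ∈ tangentSum (mulPow n k c) z Finset.univ) :
    genericRank (mulPow n k c) m = Module.finrank ℂ (Forms n (k * (c + 1))) := by
  let U : Submodule ℂ (Forms n (k * (c + 1))) :=
    { carrier := {v | ∀ᶠ z in generic (Fin m → Forms n k),
        v ∈ tangentSum (mulPow n k c) z Finset.univ}
      add_mem' := fun hx hy => by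
        rw [Set.mem_ofPred_eq] at hx hy ⊢
        exact (hx.and hy).mono fun _ h => add_mem h.1 h.2
      zero_mem' := Filter.Eventually.of_forall (f := generic (Fin m → Forms n k))
        fun _ => zero_mem _
      smul_mem' := fun a _ hx => by
        rw [Set.mem_ofPred_eq] at hx ⊢
        exact hx.mono fun _ h => Submodule.smul_mem _ a h }
  have hU : U = ⊤ := by
    refine eq_top_of_formSubst_mem (fun hb => hv ?_) fun g hg f hf => ?_
    · have : v ∈ U := h
      rwa [hb, Submodule.mem_bot] at this
    · have hu : IsUnit g.det := hg.isUnit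
      have ht := tendsto_generic_of_surjective
        (LinearMap.compLeft (formSubst k g⁻¹) (Fin m)) (fun z =>
          ⟨fun i => formSubst k g (z i), funext fun i =>
            formSubst_formSubst (Matrix.mul_nonsing_inv g hu) (z i)⟩)
      filter_upwards [ht.eventually hf] with z hz
      have := formSubst_mem_tangentSum g hz
      convert this using 2
      ext1 i
      exact (formSubst_formSubst (Matrix.nonsing_inv_mul g hu) (z i)).symm
  have hall : ∀ᶠ z in generic (Fin m → Forms n k), ∀ α,
      formBasis n (k * (c + 1)) α ∈ tangentSum (mulPow n k c) z Finset.univ :=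
    Filter.eventually_all.2 fun α => (hU.ge (Submodule.mem_top (x := formBasis n _ α)) :)
  obtain ⟨z, hz⟩ := hall.exists
  have htop : tangentSum (mulPow n k c) z Finset.univ = ⊤ := by
    rw [eq_top_iff, ← (formBasis n (k * (c + 1))).span_eq, Submodule.span_le]
    rintro _ ⟨α, rfl⟩
    exact hz α
  refine le_antisymm (genericRank_le _ m) ?_
  have := finrank_le_genericRank (mulPow n k c) z
  rwa [htop, finrank_top] at this

lemma genericRank_one {k c : ℕ} (hn : 1 ≤ n) :
    genericRank (mulPow n k c) 1 = Module.finrank ℂ (Forms n k) := by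
  have hinj : ∀ q : Forms n k, q ≠ 0 → Function.Injective (mulPow n k c q) := by
    intro q hq p r hpr
    have := congrArg Subtype.val hpr
    exact Subtype.ext (mul_left_cancel₀ (pow_ne_zero c (fun h => hq (Subtype.ext h))) this)
  have hq : (⟨X ⟨0, hn⟩ ^ k, isHomogeneous_X_pow _ _⟩ : Forms n k) ≠ 0 := fun h =>
    pow_ne_zero k (X_ne_zero _) (congrArg Subtype.val h)
  have hr : ∀ z : Fin 1 → Forms n k,
      tangentSum (mulPow n k c) z Finset.univ = (mulPow n k c (z 0)).range := by
    intro z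
    simp [tangentSum]
  apply le_antisymm
  · obtain ⟨z, hz⟩ := exists_finrank_eq_genericRank (mulPow n k c) 1
    rw [← hz, hr]
    exact LinearMap.finrank_range_le _
  · have := finrank_le_genericRank (m := 1) (mulPow n k c)
      (fun _ => ⟨X ⟨0, hn⟩ ^ k, isHomogeneous_X_pow _ _⟩)
    rwa [hr, LinearMap.finrank_range_of_inj (hinj _ hq)] at this

lemma genericRank_mulPow {k c : ℕ} (hn : 1 ≤ n) :
    let N := Nat.choose (n + k - 1) k
    let D := Nat.choose (n + k * (c + 1) - 1) (k * (c + 1))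
    (∀ m, N * (m + N) ≤ D → genericRank (mulPow n k c) m = m * N) ∧
      (∀ m, D + N ^ 2 ≤ m * N → genericRank (mulPow n k c) m = D) := by
  have h₁ : genericRank (mulPow n k c) 1 = Nat.choose (n + k - 1) k := by
    rw [genericRank_one hn, finrank_forms]
  have hμ := mulPow_mem_polyFun (n := n) (k := k) (c := c)
  refine concave_growth (Nat.choose_pos (by omega)) (genericRank_zero _)
    (fun m => finrank_forms n _ ▸ genericRank_le _ m) (le_genericRank_succ hμ)
    (fun m => h₁ ▸ genericRank_succ_le hμ m) (genericRank_concave hμ) fun m hm hlt => ?_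
  rw [← h₁] at hlt
  obtain ⟨v, hv, h⟩ := exists_ne_zero_eventually_mem_tangentSum hμ hm hlt
  rw [genericRank_eq_of_eventually_mem hv h, finrank_forms]

end Forms

section KrullDimension

lemma ringKrullDim_eq_of_isIntegral {R S : Type*} [CommRing R] [CommRing S] [Algebra R S]
    [Algebra.IsIntegral R S] [FaithfulSMul R S] : ringKrullDim S = ringKrullDim R := by
  apply le_antisymm
  · exact Order.krullDim_le_of_strictMono (PrimeSpectrum.comap (algebraMap R S))
      fun P Q h => Ideal.IsIntegral.comap_lt_comap (I := P.asIdeal) (J := Q.asIdeal) h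
  · refine iSup_le fun l => ?_
    obtain ⟨P, hP, hPl⟩ := (Ideal.nonempty_primesOver (S := S) l.head.asIdeal).some
    obtain ⟨L, hL, -⟩ := Ideal.exists_ltSeries_of_hasGoingUp l P
    rw [← hL]
    exact Order.LTSeries.length_le_krullDim L

lemma ringKrullDim_eq_of_trdeg {A : Type} [CommRing A] [IsDomain A] [Algebra ℂ A]
    [Algebra.FiniteType ℂ A] {r : ℕ} (h : Algebra.trdeg ℂ A = r) : ringKrullDim A = r := by
  obtain ⟨s, g, hg, hint⟩ := exists_integral_inj_algHom_of_fg ℂ A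
  algebraize [g.toRingHom]
  have : FaithfulSMul (MvPolynomial (Fin s) ℂ) A := (faithfulSMul_iff_algebraMap_injective _ _).2 hg
  have h₁ := trdeg_add_eq ℂ (MvPolynomial (Fin s) ℂ) (A := A)
  rw [MvPolynomial.trdeg_of_isDomain, trdeg_eq_zero, h] at h₁
  have hs : s = r := by simpa using h₁
  rw [ringKrullDim_eq_of_isIntegral (R := MvPolynomial (Fin s) ℂ),
    MvPolynomial.ringKrullDim_of_isNoetherianRing, ringKrullDim_eq_zero_of_field, hs]
  simp

end KrullDimension

section Jacobian

variable {κ τ : Type*}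

lemma pderiv_aeval [Fintype κ] (G : κ → MvPolynomial τ ℂ) (P : MvPolynomial κ ℂ) (j : τ) :
    pderiv j (aeval G P) = ∑ i, aeval G (pderiv i P) * pderiv j (G i) := by
  classical
  induction P using MvPolynomial.induction_on with
  | C a => simp
  | add p q hp hq => simp only [map_add, hp, hq, add_mul, Finset.sum_add_distrib]
  | mul_X p i hp =>
    simp only [map_mul, Derivation.leibniz, smul_eq_mul, hp, map_add, aeval_X, add_mul,
      Finset.sum_add_distrib, pderiv_X, Pi.single_apply, Finset.mul_sum]
    simp [apply_ite, mul_assoc]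

lemma eq_C_of_pderiv_eq_zero {P : MvPolynomial κ ℂ} (h : ∀ i, pderiv i P = 0) :
    P = C (coeff 0 P) := by
  classical
  ext α
  rw [coeff_C]
  split_ifs with hα
  · rw [hα]
  · obtain ⟨i, hi⟩ : ∃ i, α i ≠ 0 := by
      by_contra! hc
      exact hα (Finsupp.ext fun i => (hc i).symm)
    have := congrArg (coeff (α - Finsupp.single i 1)) (h i)
    rw [coeff_pderiv, coeff_zero,
      tsub_add_cancel_of_le (by simpa using Nat.one_le_iff_ne_zero.2 hi)] at this
    refine (mul_eq_zero.1 this).resolve_right ?_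
    exact_mod_cast Nat.succ_ne_zero ((α - (Finsupp.single i 1 : κ →₀ ℕ) : κ →₀ ℕ) i)

lemma totalDegree_pderiv_lt {P : MvPolynomial κ ℂ} {i : κ} (h : pderiv i P ≠ 0) :
    (pderiv i P).totalDegree < P.totalDegree := by
  have key : ∀ β ∈ (pderiv i P).support, (β.sum fun _ e => e) < P.totalDegree := by
    intro β hβ
    rw [mem_support_iff, coeff_pderiv] at hβ
    have := le_totalDegree (mem_support_iff.2 (left_ne_zero_of_mul hβ))
    rw [Finsupp.sum_add_index' (fun _ => rfl) (fun _ _ _ => rfl), Finsupp.sum_single_index rfl]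
      at this
    omega
  obtain ⟨β, hβ⟩ := support_nonempty.2 h
  exact (Finset.sup_lt_iff (bot_lt_of_lt (key β hβ))).2 key

/-- The Jacobian criterion for algebraic independence. -/
lemma algebraicIndependent_of_jacobian [Fintype κ] [Fintype τ] (G : κ → MvPolynomial τ ℂ)
    (p : τ → ℂ) (h : LinearIndependent ℂ fun i j => eval p (pderiv j (G i))) : AlgebraicIndependent ℂ G := by
  classical
  let J : Matrix κ τ ℂ := .of fun i j => eval p (pderiv j (G i))
  obtain ⟨B, hB⟩ : ∃ B : Matrix τ κ ℂ, J * B = 1 := by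
    rw [← Matrix.mulVec_surjective_iff_exists_right_inverse]
    have hr : J.rank = Fintype.card κ := LinearIndependent.rank_matrix h
    rw [Matrix.rank] at hr
    have := Submodule.eq_top_of_finrank_eq (hr.trans (Module.finrank_fintype_fun_eq_card ℂ).symm)
    exact LinearMap.range_eq_top.1 this
  let K : Matrix κ τ (MvPolynomial τ ℂ) := .of fun i j => pderiv j (G i)
  let B' : Matrix τ κ (MvPolynomial τ ℂ) := B.map C
  let M : Matrix κ κ (MvPolynomial τ ℂ) := K * B'
  have hdet : M.det ≠ 0 := by
    intro h0
    have : (M.map (eval p)) = 1 := by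
      rw [← hB]
      ext i j
      simp [M, J, K, B', Matrix.mul_apply]
    have h1 : eval p M.det = 1 := by
      rw [RingHom.map_det, RingHom.mapMatrix_apply, this, Matrix.det_one]
    simp [h0] at h1
  rw [algebraicIndependent_iff]
  intro P
  induction hn : P.totalDegree using Nat.strong_induction_on generalizing P with
  | _ n ih =>
  intro hP
  have hvec : Matrix.vecMul (fun i => aeval G (pderiv i P)) M = 0 := by
    simp only [M]
    rw [← Matrix.vecMul_vecMul]
    have : Matrix.vecMul (fun i => aeval G (pderiv i P)) K = 0 := by
      ext1 j
      have := pderiv_aeval G P j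
      rw [hP, map_zero] at this
      exact this.symm
    rw [this, Matrix.zero_vecMul]
  have hz := Matrix.eq_zero_of_vecMul_eq_zero hdet hvec
  have hpd : ∀ i, pderiv i P = 0 := by
    intro i
    by_contra hne
    exact hne (ih _ (hn ▸ totalDegree_pderiv_lt hne) _ rfl (congrFun hz i))
  rw [eq_C_of_pderiv_eq_zero hpd] at hP ⊢
  simpa using hP

end Jacobian

section ZariskiDimension

variable {X : Type*} [TopologicalSpace X] {ι : Type*} {c : X → ι → ℂ}

lemma isClosed_of_closure_eq_zeroLocus
    (hc : ∀ (T : Set X) (x : X), x ∈ closure T ↔ c x ∈ zeroLocus ℂ (vanishingIdeal ℂ (c '' T)))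
    (I : Ideal (MvPolynomial ι ℂ)) : IsClosed {x | c x ∈ zeroLocus ℂ I} := by
  refine isClosed_of_closure_subset fun x hx p hp => ?_
  refine (hc _ _).1 hx p ?_
  rintro _ ⟨y, hy, rfl⟩
  exact hy p hp

/-- A set is irreducible for the Zariski topology iff its vanishing ideal is prime. -/
lemma isIrreducible_iff_vanishingIdeal_isPrime
    (hc : ∀ (T : Set X) (x : X), x ∈ closure T ↔ c x ∈ zeroLocus ℂ (vanishingIdeal ℂ (c '' T)))
    (T : Set X) : IsIrreducible T ↔ (vanishingIdeal ℂ (c '' T)).IsPrime := by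
  constructor
  · rintro ⟨⟨x, hx⟩, h⟩
    rw [isPreirreducible_iff_isClosed_union_isClosed] at h
    refine ⟨fun htop => ?_, fun {p q} hpq => ?_⟩
    · have h1 : (1 : MvPolynomial ι ℂ) ∈ vanishingIdeal ℂ (c '' T) := by rw [htop]; trivial
      simpa using h1 _ ⟨x, hx, rfl⟩
    · have hcl := fun r => isClosed_of_closure_eq_zeroLocus hc (Ideal.span {r})
      have hmem : ∀ (r : MvPolynomial ι ℂ) x,
          x ∈ {x | c x ∈ zeroLocus ℂ (Ideal.span {r})} ↔ aeval (c x) r = 0 := by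
        intro r x
        simp [zeroLocus_span]
      refine (h _ _ (hcl p) (hcl q) fun x hx => ?_).imp (fun h' => ?_) fun h' => ?_
      · have := hpq _ ⟨x, hx, rfl⟩
        rw [map_mul, mul_eq_zero] at this
        exact this.imp (hmem p x).2 (hmem q x).2
      all_goals
        rintro _ ⟨x, hx, rfl⟩
        exact (hmem _ x).1 (h' hx)
  · intro h
    refine ⟨Set.nonempty_iff_ne_empty.2 ?_, ?_⟩
    · rintro rfl
      exact h.ne_top (by rw [Set.image_empty, vanishingIdeal_empty])
    · rw [isPreirreducible_iff_isClosed_union_isClosed]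
      intro Z₁ Z₂ h₁ h₂ hT
      by_contra! hcon
      have key : ∀ Z : Set X, IsClosed Z → ¬ T ⊆ Z → ∃ p, (∀ z ∈ Z, aeval (c z) p = 0) ∧
          p ∉ vanishingIdeal ℂ (c '' T) := by
        intro Z hZ hTZ
        obtain ⟨x, hx, hxZ⟩ := Set.not_subset.1 hTZ
        rw [← hZ.closure_eq, hc, mem_zeroLocus_iff] at hxZ
        push Not at hxZ
        obtain ⟨p, hp, hpx⟩ := hxZ
        exact ⟨p, fun z hz => hp _ ⟨z, hz, rfl⟩, fun h => hpx (h _ ⟨x, hx, rfl⟩)⟩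
      obtain ⟨p, hp, hpT⟩ := key Z₁ h₁ hcon.1
      obtain ⟨q, hq, hqT⟩ := key Z₂ h₂ hcon.2
      refine (h.mem_or_mem (x := p) (y := q) ?_).elim hpT hqT
      rintro _ ⟨x, hx, rfl⟩
      rw [map_mul, mul_eq_zero]
      exact (hT hx).imp (hp x) (hq x)

/-- The Krull dimension of an affine variety is that of its coordinate ring. -/
lemma topologicalKrullDim_eq_ringKrullDim [Finite ι]
    (hc : ∀ (T : Set X) (x : X), x ∈ closure T ↔ c x ∈ zeroLocus ℂ (vanishingIdeal ℂ (c '' T)))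
    (hrange : zeroLocus ℂ (vanishingIdeal ℂ (Set.range c)) ⊆ Set.range c) :
    topologicalKrullDim X =
      ringKrullDim (MvPolynomial ι ℂ ⧸ vanishingIdeal ℂ (Set.range c)) := by
  rw [ringKrullDim_quotient, topologicalKrullDim, ← Order.krullDim_orderDual]
  have hprime : ∀ Z : TopologicalSpace.IrreducibleCloseds X,
      (vanishingIdeal ℂ (c '' Z)).IsPrime := fun Z =>
    (isIrreducible_iff_vanishingIdeal_isPrime hc _).1 Z.isIrreducible
  have himage : ∀ P : Ideal (MvPolynomial ι ℂ), vanishingIdeal ℂ (Set.range c) ≤ P →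
      c '' {x | c x ∈ zeroLocus ℂ P} = zeroLocus ℂ P := by
    intro P hP
    refine Set.Subset.antisymm (by rintro _ ⟨x, hx, rfl⟩; exact hx) fun y hy => ?_
    obtain ⟨x, rfl⟩ := hrange (zeroLocus_anti_mono hP hy)
    exact ⟨x, hy, rfl⟩
  have hideal : ∀ P : PrimeSpectrum.zeroLocus
      (vanishingIdeal ℂ (Set.range c) : Set (MvPolynomial ι ℂ)),
      vanishingIdeal ℂ (c '' {x | c x ∈ zeroLocus ℂ P.1.asIdeal}) = P.1.asIdeal := by
    intro P
    have := P.1.isPrime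
    rw [himage _ P.2, IsPrime.vanishingIdeal_zeroLocus]
  refine le_antisymm
    (Order.krullDim_le_of_strictMono (fun Z : (TopologicalSpace.IrreducibleCloseds X)ᵒᵈ =>
      (⟨⟨vanishingIdeal ℂ (c '' ((OrderDual.ofDual Z : TopologicalSpace.IrreducibleCloseds X) : Set X)),
        hprime _⟩,
        vanishingIdeal_anti_mono (Set.image_subset_range _ _)⟩ :
        PrimeSpectrum.zeroLocus (vanishingIdeal ℂ (Set.range c) : Set (MvPolynomial ι ℂ)))) ?_)
    (Order.krullDim_le_of_strictMono (fun P => OrderDual.toDual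
      (⟨{x | c x ∈ zeroLocus ℂ P.1.asIdeal},
        (isIrreducible_iff_vanishingIdeal_isPrime hc _).2 (by rw [hideal P]; exact P.1.isPrime),
        isClosed_of_closure_eq_zeroLocus hc _⟩ : TopologicalSpace.IrreducibleCloseds X)) ?_)
  · intro Z₁ Z₂ h
    have hsub : ∀ Z₁ Z₂ : TopologicalSpace.IrreducibleCloseds X,
        vanishingIdeal ℂ (c '' Z₂) ≤ vanishingIdeal ℂ (c '' Z₁) → Z₁ ≤ Z₂ := by
      intro Z₁ Z₂ h x hx
      have : x ∈ closure (Z₂ : Set X) :=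
        (hc _ _).2 fun p hp => h hp _ ⟨x, hx, rfl⟩
      rwa [Z₂.isClosed.closure_eq] at this
    rw [lt_iff_le_not_ge] at h ⊢
    exact ⟨vanishingIdeal_anti_mono (Set.image_mono h.1), fun h' => h.2 (hsub _ _ h')⟩
  · intro P Q h
    rw [lt_iff_le_not_ge] at h ⊢
    refine ⟨fun x hx => zeroLocus_anti_mono h.1 hx, fun h' => h.2 ?_⟩
    change Q.1.asIdeal ≤ P.1.asIdeal
    rw [← hideal P, ← hideal Q]
    exact vanishingIdeal_anti_mono (Set.image_mono h')

end ZariskiDimension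

section ZariskiTopology

variable {M : Type*} [AddCommGroup M] [Module ℂ M] {ι : Type*} [Fintype ι]

lemma mem_polyFun_iff (b : Module.Basis ι ℂ M) (f : M → ℂ) :
    f ∈ polyFun M ↔ ∃ p : MvPolynomial ι ℂ, f = fun x => aeval (b.equivFun x) p := by
  constructor
  · intro hf
    induction hf using Algebra.adjoin_induction with
    | mem g hg =>
      obtain ⟨φ, rfl⟩ := hg
      refine ⟨∑ i, C (φ (b i)) * X i, funext fun x => ?_⟩
      conv_lhs => rw [← b.sum_equivFun x]
      simp only [map_sum, map_smul, map_mul, smul_eq_mul, aeval_X, aeval_C,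
        Algebra.algebraMap_self_apply, mul_comm]
    | algebraMap r => exact ⟨C r, funext fun x => by simp⟩
    | add f g _ _ hf hg =>
      obtain ⟨p, rfl⟩ := hf
      obtain ⟨q, rfl⟩ := hg
      exact ⟨p + q, funext fun x => by simp⟩
    | mul f g _ _ hf hg =>
      obtain ⟨p, rfl⟩ := hf
      obtain ⟨q, rfl⟩ := hg
      exact ⟨p * q, funext fun x => by simp⟩
  · rintro ⟨p, rfl⟩
    induction p using MvPolynomial.induction_on with
    | C a => simpa using const_mem_polyFun a
    | add p q hp hq =>
      simp only [map_add]
      exact add_mem hp hq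
    | mul_X p i hp =>
      simp only [map_mul, aeval_X]
      exact mul_mem hp (dual_mem_polyFun (b.coord i))

lemma isOpen_setOf_polyFun_ne_zero [FiniteDimensional ℂ M] {f : M → ℂ} (hf : f ∈ polyFun M) :
    @IsOpen _ (ztV M) {x | f x ≠ 0} := by
  obtain ⟨p, rfl⟩ := (mem_polyFun_iff (Module.finBasis ℂ M) f).1 hf
  exact TopologicalSpace.isOpen_generateFrom_of_mem
    ⟨_, p, fun i => (Module.finBasis ℂ M).coord i, rfl⟩

lemma exists_polyFun_of_isOpen {U : Set M} (hU : @IsOpen _ (ztV M) U) {x : M} (hx : x ∈ U) :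
    ∃ f ∈ polyFun M, f x ≠ 0 ∧ ∀ y, f y ≠ 0 → y ∈ U := by
  induction hU with
  | basic s hs =>
    obtain ⟨k, p, L, rfl⟩ := hs
    refine ⟨_, comp_linear_mem_polyFun (LinearMap.pi L)
      ((mem_polyFun_iff (Pi.basisFun ℂ (Fin k)) _).2 ⟨p, rfl⟩), ?_⟩
    exact ⟨hx, fun y hy => hy⟩
  | univ => exact ⟨1, one_mem _, one_ne_zero, fun _ _ => trivial⟩
  | inter s t _ _ hs ht =>
    obtain ⟨f, hf, hfx, hfs⟩ := hs hx.1
    obtain ⟨g, hg, hgx, hgt⟩ := ht hx.2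
    exact ⟨f * g, mul_mem hf hg, mul_ne_zero hfx hgx, fun y hy =>
      ⟨hfs y (left_ne_zero_of_mul hy), hgt y (right_ne_zero_of_mul hy)⟩⟩
  | sUnion S _ ih =>
    obtain ⟨s, hs, hxs⟩ := hx
    obtain ⟨f, hf, hfx, hfs⟩ := ih s hs hxs
    exact ⟨f, hf, hfx, fun y hy => ⟨s, hs, hfs y hy⟩⟩

lemma mem_zClosureV_iff [FiniteDimensional ℂ M] (S : Set M) (x : M) :
    x ∈ zClosureV S ↔ ∀ f ∈ polyFun M, (∀ s ∈ S, f s = 0) → f x = 0 := by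
  rw [zClosureV, @mem_closure_iff _ (ztV M)]
  constructor
  · intro h f hf hS
    by_contra hfx
    obtain ⟨s, hs, hsS⟩ := h _ (isOpen_setOf_polyFun_ne_zero hf) hfx
    exact hs (hS s hsS)
  · intro h U hU hxU
    obtain ⟨f, hf, hfx, hfU⟩ := exists_polyFun_of_isOpen hU hxU
    by_contra hne
    refine hfx (h f hf fun s hs => ?_)
    by_contra hfs
    exact hne ⟨s, hfU s hfs, hs⟩

lemma mem_zClosureV_iff_mem_zeroLocus (b : Module.Basis ι ℂ M) (S : Set M) (x : M) :
    x ∈ zClosureV S ↔ b.equivFun x ∈ zeroLocus ℂ (vanishingIdeal ℂ (b.equivFun '' S)) := by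
  have := Module.Finite.of_basis b
  rw [mem_zClosureV_iff]
  constructor
  · exact fun h p hp => h _ ((mem_polyFun_iff b _).2 ⟨p, rfl⟩) fun s hs => hp _ ⟨s, hs, rfl⟩
  · intro h f hf hS
    obtain ⟨p, rfl⟩ := (mem_polyFun_iff b f).1 hf
    exact h p (by rintro _ ⟨s, hs, rfl⟩; exact hS s hs)

lemma vanishingIdeal_zClosureV (b : Module.Basis ι ℂ M) (S : Set M) :
    vanishingIdeal ℂ (b.equivFun '' zClosureV S) = vanishingIdeal ℂ (b.equivFun '' S) := by
  refine le_antisymm (vanishingIdeal_anti_mono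
    (Set.image_mono (@subset_closure _ (ztV M) S))) fun p hp => ?_
  rintro _ ⟨x, hx, rfl⟩
  exact (mem_zClosureV_iff_mem_zeroLocus b S x).1 hx p hp

/-- The dimension of the closure of `S` is the dimension of the coordinate ring of `S`. -/
lemma zDimV_zClosureV (b : Module.Basis ι ℂ M) (S : Set M) :
    zDimV (zClosureV S) =
      ringKrullDim (MvPolynomial ι ℂ ⧸ vanishingIdeal ℂ (b.equivFun '' S)) := by
  let _ := ztV M
  have hrange : Set.range (fun x : zClosureV S => b.equivFun x) = b.equivFun '' zClosureV S :=
    (Set.range_comp _ _).trans (by rw [Subtype.range_coe])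
  have := topologicalKrullDim_eq_ringKrullDim (X := zClosureV S) (c := fun x => b.equivFun x) ?_ ?_
  · rw [hrange, vanishingIdeal_zClosureV] at this
    exact this
  · intro T x
    rw [closure_subtype]
    have := mem_zClosureV_iff_mem_zeroLocus b (Subtype.val '' T) x
    rw [Set.image_image] at this
    exact this
  · rw [hrange, vanishingIdeal_zClosureV]
    intro y hy
    obtain ⟨x, rfl⟩ := b.equivFun.surjective y
    exact ⟨x, (mem_zClosureV_iff_mem_zeroLocus b S x).2 hy, rfl⟩

end ZariskiTopology

section PolynomialMap

variable {ι τ : Type}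

lemma vanishingIdeal_range_eval (F : ι → MvPolynomial τ ℂ) :
    vanishingIdeal ℂ (Set.range fun (v : τ → ℂ) i => eval v (F i)) =
      RingHom.ker (aeval F : MvPolynomial ι ℂ →ₐ[ℂ] MvPolynomial τ ℂ) := by
  ext p
  have key : ∀ v : τ → ℂ, aeval (fun i => eval v (F i)) p = eval v (aeval F p) := by
    intro v
    have : (aeval fun i => eval v (F i)) = (aeval v : MvPolynomial τ ℂ →ₐ[ℂ] ℂ).comp (aeval F) := by
      ext i
      simp [aeval_eq_eval]
    rw [this]
    simp [aeval_eq_eval]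
  rw [mem_vanishingIdeal_iff, RingHom.mem_ker, Set.forall_mem_range]
  simp only [key]
  exact ⟨fun h => MvPolynomial.funext fun v => by simpa using h v, fun h v => by simp_all⟩

/-- The Jacobian matrix of a polynomial map at a point. -/
def jacobian (F : ι → MvPolynomial τ ℂ) (p : τ → ℂ) : Matrix ι τ ℂ :=
  Matrix.of fun i j => eval p (pderiv j (F i))

variable [Fintype ι] [Fintype τ]

/-- If the Jacobian has full column rank at some point, the image of a polynomial map has the
dimension of the source. -/
lemma ringKrullDim_quotient_ker_aeval {F : ι → MvPolynomial τ ℂ} {p : τ → ℂ}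
    (h : (jacobian F p).rank = Fintype.card τ) :
    ringKrullDim (MvPolynomial ι ℂ ⧸
      RingHom.ker (aeval F : MvPolynomial ι ℂ →ₐ[ℂ] MvPolynomial τ ℂ)) = Fintype.card τ := by
  set f : MvPolynomial ι ℂ →ₐ[ℂ] MvPolynomial τ ℂ := aeval F
  have hker : RingHom.ker f = RingHom.ker f.rangeRestrict := by
    ext
    simp [RingHom.mem_ker, Subtype.ext_iff]
  rw [hker, ringKrullDim_eq_of_ringEquiv
    (Ideal.quotientKerAlgEquivOfSurjective f.rangeRestrict_surjective).toRingEquiv]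
  have : Algebra.FiniteType ℂ f.range := Algebra.FiniteType.of_surjective _ f.rangeRestrict_surjective
  refine ringKrullDim_eq_of_trdeg (le_antisymm ?_ ?_)
  · refine (trdeg_le_of_injective f.range.val Subtype.val_injective).trans ?_
    rw [MvPolynomial.trdeg_of_isDomain]
    simp
  · obtain ⟨κ, a, ha, hspan, hli⟩ := exists_linearIndependent' ℂ (jacobian F p).row
    have : Fintype κ := Fintype.ofInjective a ha
    have hcard : Fintype.card κ = Fintype.card τ := by
      rw [← h, Matrix.rank_eq_finrank_span_row, ← hspan, finrank_span_eq_card hli]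
    have hind : AlgebraicIndependent ℂ (fun j => F (a j)) := algebraicIndependent_of_jacobian _ p hli
    have hind' : AlgebraicIndependent ℂ (fun j => (⟨F (a j), ⟨X (a j), aeval_X _ _⟩⟩ : f.range)) :=
      AlgebraicIndependent.of_comp f.range.val hind
    have := hind'.cardinalMk_le_trdeg
    rwa [Cardinal.mk_fintype, hcard] at this

/-- If the Jacobian has full row rank at some point, a polynomial map is dominant. -/
lemma ker_aeval_eq_bot {F : ι → MvPolynomial τ ℂ} {p : τ → ℂ}
    (h : (jacobian F p).rank = Fintype.card ι) :
    RingHom.ker (aeval F : MvPolynomial ι ℂ →ₐ[ℂ] MvPolynomial τ ℂ) = ⊥ := by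
  have hli : LinearIndependent ℂ (jacobian F p).row := by
    rw [linearIndependent_iff_card_eq_finrank_span, Set.finrank, ← Matrix.rank_eq_finrank_span_row, h]
  exact (RingHom.injective_iff_ker_eq_bot _).1 (algebraicIndependent_of_jacobian F p hli)

end PolynomialMap

section CoefficientDerivation

variable {σ R : Type*} [CommRing R] [Algebra ℂ R]

/-- `P'` is obtained from `P` by applying a derivation to the coefficients. -/
def IsCoeffDeriv (δ : Derivation ℂ R R) (P P' : MvPolynomial σ R) : Prop :=
  ∀ α, coeff α P' = δ (coeff α P)

namespace IsCoeffDeriv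

variable {δ : Derivation ℂ R R} {P P' Q Q' : MvPolynomial σ R}

lemma mul (hP : IsCoeffDeriv δ P P') (hQ : IsCoeffDeriv δ Q Q') :
    IsCoeffDeriv δ (P * Q) (P * Q' + P' * Q) := fun α => by
  classical
  simp only [coeff_add, coeff_mul, map_sum, Derivation.leibniz, smul_eq_mul, hP _, hQ _,
    Finset.sum_add_distrib]
  congr 1
  exact Finset.sum_congr rfl fun x _ => mul_comm _ _

lemma pow_succ (hP : IsCoeffDeriv δ P P') (c : ℕ) :
    IsCoeffDeriv δ (P ^ (c + 1)) ((c + 1 : ℕ) • (P ^ c * P')) := by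
  induction c with
  | zero => simpa using hP
  | succ c ih =>
    rw [_root_.pow_succ]
    convert ih.mul hP using 1
    simp only [nsmul_eq_mul]
    push_cast
    ring

lemma sum {ι : Type*} (s : Finset ι) {P P' : ι → MvPolynomial σ R}
    (h : ∀ i ∈ s, IsCoeffDeriv δ (P i) (P' i)) : IsCoeffDeriv δ (∑ i ∈ s, P i) (∑ i ∈ s, P' i) :=
  fun α => by
    simp only [coeff_sum, map_sum]
    exact Finset.sum_congr rfl fun i hi => h i hi α

end IsCoeffDeriv

end CoefficientDerivation

section PowerSums

variable (n k c m : ℕ)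

/-- The form of degree `k` whose coefficients are the `i`-th group of variables. -/
def genericForm (i : Fin m) :
    MvPolynomial (Fin n) (MvPolynomial (Σ _ : Fin m, Exponents n k) ℂ) :=
  ∑ β : Exponents n k, monomial β.1 (X ⟨i, β⟩)

/-- The coefficients of a sum of powers of generic forms. -/
def powerSumCoeff (α : Exponents n (k * (c + 1))) : MvPolynomial (Σ _ : Fin m, Exponents n k) ℂ :=
  coeff α.1 (∑ i, genericForm n k m i ^ (c + 1))

/-- The coefficients of a tuple of forms. -/
def tupleBasis : Module.Basis (Σ _ : Fin m, Exponents n k) ℂ (Fin m → Forms n k) :=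
  Pi.basis fun _ => formBasis n k

/-- The sum of the `(c + 1)`-st powers of a tuple of forms. -/
def powerSum (q : Fin m → Forms n k) : Forms n (k * (c + 1)) :=
  ∑ i, mulPow n k c (q i) (q i)

variable {n k c m}

lemma tupleBasis_equivFun (q : Fin m → Forms n k) (i : Fin m) (β : Exponents n k) :
    (tupleBasis n k m).equivFun q ⟨i, β⟩ = coeff β.1 (q i).1 := by
  simp [tupleBasis, Pi.basis_repr, formBasis_repr]

lemma map_genericForm (q : Fin m → Forms n k) (i : Fin m) :
    map (eval ((tupleBasis n k m).equivFun q)) (genericForm n k m i) = (q i).1 := by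
  have h : (⟨∑ β : Exponents n k, monomial β.1 (coeff β.1 (q i).1), sum_mem fun α _ =>
    isHomogeneous_monomial _ α.2⟩ : Forms n k) = q i := (coeffEquiv n k).symm_apply_apply (q i)
  rw [← congrArg Subtype.val h]
  simp only [genericForm, map_sum, map_monomial, eval_X, tupleBasis_equivFun]

lemma coe_powerSum (q : Fin m → Forms n k) :
    (powerSum n k c m q).1 = ∑ i, (q i).1 ^ (c + 1) := by
  simp [powerSum, mulPow, pow_succ]

lemma eval_powerSumCoeff (q : Fin m → Forms n k) (α : Exponents n (k * (c + 1))) :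
    eval ((tupleBasis n k m).equivFun q) (powerSumCoeff n k c m α) =
      (formBasis n (k * (c + 1))).equivFun (powerSum n k c m q) α := by
  rw [powerSumCoeff, ← coeff_map, Module.Basis.equivFun_apply (formBasis _ _), formBasis_repr,
    coe_powerSum]
  simp only [map_sum, map_pow, map_genericForm]

lemma isCoeffDeriv_genericForm (i j : Fin m) (β : Exponents n k) :
    IsCoeffDeriv (pderiv ⟨i, β⟩) (genericForm n k m j) (if j = i then monomial β.1 1 else 0) := by
  classical
  intro α
  simp only [genericForm, coeff_sum, coeff_monomial, map_sum]
  split_ifs with h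
  · subst h
    rw [Finset.sum_eq_single β]
    · rw [coeff_monomial]
      split_ifs <;> simp
    · intro γ _ hγ
      split_ifs
      · exact pderiv_X_of_ne (by simpa using hγ)
      · simp
    · simp
  · rw [coeff_zero, Finset.sum_eq_zero]
    intro γ _
    split_ifs
    · exact pderiv_X_of_ne (by simpa using fun h' => absurd h' h)
    · simp

lemma tupleBasis_apply (i : Fin m) (β : Exponents n k) :
    tupleBasis n k m ⟨i, β⟩ = Pi.single i (formBasis n k β) := by
  classical
  simp [tupleBasis, Pi.basis_apply]

lemma coe_formBasis {n e : ℕ} (β : Exponents n e) : (formBasis n e β).1 = monomial β.1 1 := by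
  classical
  ext α
  by_cases hα : α.degree = e
  · rw [← formBasis_repr (formBasis n e β) ⟨α, hα⟩, Module.Basis.repr_self, Finsupp.single_apply,
      coeff_monomial]
    exact if_congr Subtype.ext_iff rfl rfl
  · rw [coeff_monomial, if_neg (by rintro rfl; exact hα β.2)]
    by_contra hne
    have := (formBasis n e β).2 hne
    exact hα (by rw [← this, Finsupp.degree_eq_weight_one]; rfl)

lemma tangentSumMap_single {E V ι : Type*} [AddCommGroup E] [Module ℂ E] [AddCommGroup V]
    [Module ℂ V] [Fintype ι] [DecidableEq ι] (μ : E → E →ₗ[ℂ] V) (q : ι → E) (i : ι) (v : E) :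
    tangentSumMap μ q Finset.univ (Pi.single i v) = μ (q i) v := by
  simp only [tangentSumMap, LinearMap.sum_apply, LinearMap.comp_apply, LinearMap.proj_apply]
  rw [Finset.sum_eq_single i _ (by simp), Pi.single_eq_same]
  intro j _ hj
  rw [Pi.single_eq_of_ne hj, map_zero]

lemma jacobian_powerSumCoeff (q : Fin m → Forms n k) :
    jacobian (powerSumCoeff n k c m) ((tupleBasis n k m).equivFun q) =
      ((c + 1 : ℕ) : ℂ) • LinearMap.toMatrix (tupleBasis n k m) (formBasis n (k * (c + 1)))
        (tangentSumMap (mulPow n k c) q Finset.univ) := by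
  classical
  ext α ⟨i, β⟩
  have h := IsCoeffDeriv.sum Finset.univ fun j _ =>
    (isCoeffDeriv_genericForm (m := m) i j β).pow_succ c
  have h' := congrArg (eval ((tupleBasis n k m).equivFun q)) (h α.1)
  rw [Matrix.smul_apply, LinearMap.toMatrix_apply, formBasis_repr, tupleBasis_apply,
    tangentSumMap_single]
  refine h'.symm.trans ?_
  rw [← coeff_map]
  simp only [map_sum, map_nsmul, map_mul, map_pow, map_genericForm]
  rw [Finset.sum_eq_single i]
  · simp only [if_true, map_monomial, map_one, nsmul_eq_mul, smul_eq_mul, mulPow, LinearMap.coe_mk,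
      AddHom.coe_mk, coe_formBasis]
    rw [← map_natCast (C : ℂ →+* MvPolynomial (Fin n) ℂ), coeff_C_mul]
  · intro j _ hj
    simp [hj]
  · simp

lemma rank_jacobian_powerSumCoeff (q : Fin m → Forms n k) :
    (jacobian (powerSumCoeff n k c m) ((tupleBasis n k m).equivFun q)).rank =
      Module.finrank ℂ (tangentSum (mulPow n k c) q Finset.univ) := by
  classical
  rw [jacobian_powerSumCoeff, Matrix.rank_smul_of_mem_nonZeroDivisors _
    (mem_nonZeroDivisors_of_ne_zero (by exact_mod_cast c.succ_ne_zero)),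
    Matrix.rank_eq_finrank_range_toLin _ (formBasis n (k * (c + 1))) (tupleBasis n k m),
    Matrix.toLin_toMatrix, range_tangentSumMap]

lemma image_range_powerSum :
    (formBasis n (k * (c + 1))).equivFun '' Set.range (powerSum n k c m) =
      Set.range fun (v : (Σ _ : Fin m, Exponents n k) → ℂ) α =>
        eval v (powerSumCoeff n k c m α) := by
  rw [← Set.range_comp, ← (tupleBasis n k m).equivFun.surjective.range_comp]
  congr 1
  ext q α
  exact (eval_powerSumCoeff q α).symm

lemma zDimV_zClosureV_range_powerSum
    (h : genericRank (mulPow n k c) m = m * Nat.choose (n + k - 1) k) :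
    zDimV (zClosureV (Set.range (powerSum n k c m))) =
      ((m * Nat.choose (n + k - 1) k : ℕ) : WithBot ℕ∞) := by
  obtain ⟨q, hq⟩ := exists_finrank_eq_genericRank (mulPow n k c) m
  have hcard : Fintype.card (Σ _ : Fin m, Exponents n k) = m * Nat.choose (n + k - 1) k := by
    simp [card_exponents]
  rw [zDimV_zClosureV (formBasis n (k * (c + 1))), image_range_powerSum, vanishingIdeal_range_eval,
    ringKrullDim_quotient_ker_aeval ((rank_jacobian_powerSumCoeff q).trans (by rw [hq, h, hcard])),
    hcard]

lemma zClosureV_range_powerSum_eq_univ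
    (h : genericRank (mulPow n k c) m = Nat.choose (n + k * (c + 1) - 1) (k * (c + 1))) :
    zClosureV (Set.range (powerSum n k c m)) = Set.univ := by
  obtain ⟨q, hq⟩ := exists_finrank_eq_genericRank (mulPow n k c) m
  refine Set.eq_univ_of_forall fun x => ?_
  rw [mem_zClosureV_iff_mem_zeroLocus (formBasis n (k * (c + 1))), image_range_powerSum,
    vanishingIdeal_range_eval, ker_aeval_eq_bot
      ((rank_jacobian_powerSumCoeff q).trans (by rw [hq, h, card_exponents])), zeroLocus_bot]
  trivial

end PowerSums

section Secants

variable {M : Type*} [AddCommGroup M] [Module ℂ M]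

lemma zClosureV_subset_iff {S T : Set M} : zClosureV S ⊆ zClosureV T ↔ S ⊆ zClosureV T :=
  @IsClosed.closure_subset_iff _ (ztV M) _ _ (@isClosed_closure _ (ztV M) T)

lemma subset_zClosureV (S : Set M) : S ⊆ zClosureV S := @subset_closure _ (ztV M) S

variable [FiniteDimensional ℂ M]

lemma sum_mem_zClosureV {m : ℕ} {S : Set M} {x : Fin m → M} (hx : ∀ i, x i ∈ zClosureV S) :
    ∑ i, x i ∈ zClosureV {p | ∃ x : Fin m → M, (∀ i, x i ∈ S) ∧ p = ∑ i, x i} := by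
  rw [mem_zClosureV_iff]
  intro f hf hS
  suffices H : ∀ (s : Finset (Fin m)) (x : Fin m → M), (∀ i, x i ∈ zClosureV S) →
      (∀ i ∉ s, x i ∈ S) → f (∑ i, x i) = 0 from H Finset.univ x hx (by simp)
  intro s
  induction s using Finset.induction_on with
  | empty => exact fun x _ hx => hS _ ⟨x, fun i => hx i (by simp), rfl⟩
  | insert a s ha ih =>
    intro x hx hxs
    have hsum : ∀ y, ∑ i, Function.update x a y i = y + ∑ i ∈ Finset.univ.erase a, x i := by
      intro y
      rw [← Finset.add_sum_erase _ _ (Finset.mem_univ a), Function.update_self]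
      congr 1
      exact Finset.sum_congr rfl fun i hi => Function.update_of_ne (Finset.ne_of_mem_erase hi) _ _
    have hg : (fun y => f (y + ∑ i ∈ Finset.univ.erase a, x i)) ∈ polyFun M :=
      comp_mem_polyFun (fun φ => by
        simp only [map_add]
        exact add_mem (dual_mem_polyFun φ) (const_mem_polyFun _)) hf
    have := (mem_zClosureV_iff S (x a)).1 (hx a) _ hg fun y hy => by
      rw [← hsum]
      refine ih _ (fun i => ?_) fun i hi => ?_
      · rcases eq_or_ne i a with rfl | hia
        · simpa using subset_zClosureV S hy
        · simpa [hia] using hx i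
      · rcases eq_or_ne i a with rfl | hia
        · simpa using hy
        · simpa [hia] using hxs i (by simp [hia, hi])
    rwa [← hsum, Function.update_eq_self] at this

lemma secantV_zClosureV (m : ℕ) (S : Set M) :
    secantV m (zClosureV S) = zClosureV {p | ∃ x : Fin m → M, (∀ i, x i ∈ S) ∧ p = ∑ i, x i} := by
  refine Set.Subset.antisymm (zClosureV_subset_iff.2 ?_) (zClosureV_subset_iff.2 ?_)
  · rintro _ ⟨x, hx, rfl⟩
    exact sum_mem_zClosureV hx
  · rintro _ ⟨x, hx, rfl⟩
    exact subset_zClosureV _ ⟨x, fun i => subset_zClosureV S (hx i), rfl⟩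

end Secants

lemma secantV_powVariety (n k c m : ℕ) :
    secantV m (PowVariety n k (c + 1)) = zClosureV (Set.range (powerSum n k c m)) := by
  rw [PowVariety, secantV_zClosureV]
  congr 1
  ext f
  constructor
  · rintro ⟨x, hx, rfl⟩
    choose q hq hqx using hx
    refine ⟨fun i => ⟨q i, hq i⟩, Subtype.ext ?_⟩
    rw [coe_powerSum]
    simp [hqx]
  · rintro ⟨q, rfl⟩
    exact ⟨fun i => mulPow n k c (q i) (q i), fun i => ⟨(q i).1, (q i).2, (pow_succ _ _).symm⟩, rfl⟩

lemma secantV_one_powVariety (n k c : ℕ) :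
    secantV 1 (PowVariety n k (c + 1)) = PowVariety n k (c + 1) := by
  rw [PowVariety, secantV_zClosureV]
  congr 1
  ext f
  constructor
  · rintro ⟨x, hx, rfl⟩
    simpa using hx 0
  · exact fun hf => ⟨fun _ => f, fun _ => hf, by simp⟩

theorem stmt_17 (n k d : ℕ) (hn : 1 ≤ n) (hk : 1 ≤ k) (hd : 1 ≤ d)
    (N : ℕ) (hN : N = Nat.choose (n + k - 1) k) :
    zDimV (PowVariety n k d) = (N : WithBot ℕ∞) ∧
    (∀ m : ℕ, 1 ≤ m → N * (m + N) ≤ Nat.choose (n + k * d - 1) (k * d) →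
      zDimV (secantV m (PowVariety n k d)) = ((m * N : ℕ) : WithBot ℕ∞)) ∧
    (∀ m : ℕ, 1 ≤ m → Nat.choose (n + k * d - 1) (k * d) + N ^ 2 ≤ m * N →
      secantV m (PowVariety n k d) = Set.univ) := by
  obtain ⟨c, rfl⟩ : ∃ c, d = c + 1 := ⟨d - 1, by omega⟩
  subst hN
  have hrank := genericRank_mulPow (n := n) (k := k) (c := c) hn
  refine ⟨?_, fun m _ h => ?_, fun m _ h => ?_⟩
  · rw [← secantV_one_powVariety, secantV_powVariety, zDimV_zClosureV_range_powerSum, one_mul]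
    rw [genericRank_one hn, finrank_forms, one_mul]
  · rw [secantV_powVariety, zDimV_zClosureV_range_powerSum (hrank.1 m h)]
  · rw [secantV_powVariety, zClosureV_range_powerSum_eq_univ (hrank.2 m h)]
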